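/- Suppose the weight function w is symmetric and belongs to Γ(r,Δ) for some r > 0 and Δ > 0, x is a solution of the opinion dynamics, and μ_∞ is a finite Borel measure on [0,1] such that μ_t converges in distribution to μ_∞. Then there exist finitely many points z_1, …, z_k ∈ [0,1] and a real number l > 0 such that: (1) every closed interval I ⊆ ℝ containing none of the points z_1, …, z_k satisfies μ_∞(I) = 0; and (2) every closed interval I whose interior contains at least one of the points z_1, …, z_k satisfies μ_∞(I) ≥ l. -/

import Mathlib

open MeasureTheory Filter Set Topology

/-- The interaction field at time `t` for agent `α`:
`∫_0^1 w(t,α,β,x_t(α),x_t(β)) · (x_t(β) − x_t(α)) dβ`. -/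
noncomputable def interactionField (w : ℝ → ℝ → ℝ → ℝ → ℝ → ℝ) (x : ℝ → ℝ → ℝ)
    (t α : ℝ) : ℝ :=
  ∫ β in (0:ℝ)..1, w t α β (x t α) (x t β) * (x t β - x t α)

/-- `f` is absolutely continuous on the compact interval `[a,b]`. -/
def AbsolutelyContinuousOn (f : ℝ → ℝ) (a b : ℝ) : Prop :=
  ∀ ε > 0, ∃ δ > 0, ∀ n : ℕ, ∀ c d : Fin n → ℝ,
    (∀ i, a ≤ c i ∧ c i ≤ d i ∧ d i ≤ b) →
    (Pairwise fun i j => Set.Ioo (c i) (d i) ∩ Set.Ioo (c j) (d j) = ∅) →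
    (∑ i, (d i - c i)) < δ → (∑ i, |f (d i) - f (c i)|) < ε

/-- `w` is an admissible weight function: jointly Borel measurable, nonnegative and
bounded by `W` on the domain `[0,∞) × [0,1] × [0,1] × ℝ × ℝ`. -/
structure IsWeight (W : ℝ) (w : ℝ → ℝ → ℝ → ℝ → ℝ → ℝ) : Prop where
  measurable : Measurable fun p : ℝ × ℝ × ℝ × ℝ × ℝ =>
    w p.1 p.2.1 p.2.2.1 p.2.2.2.1 p.2.2.2.2
  nonneg : ∀ t, 0 ≤ t → ∀ α ∈ Icc (0:ℝ) 1, ∀ β ∈ Icc (0:ℝ) 1, ∀ a b : ℝ,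
    0 ≤ w t α β a b
  le_bound : ∀ t, 0 ≤ t → ∀ α ∈ Icc (0:ℝ) 1, ∀ β ∈ Icc (0:ℝ) 1, ∀ a b : ℝ,
    w t α β a b ≤ W

/-- `x` is a solution of the opinion dynamics with weight function `w`:
measurable in the agent, absolutely continuous in time on compact intervals,
with initial opinions in `[0,1]`, locally bounded, and for each agent satisfying
the ODE `(d/dt) x_t(α) = ∫_0^1 w(t,α,β,x_t(α),x_t(β))·(x_t(β) − x_t(α)) dβ`
for almost every `t ≥ 0`. -/
structure IsSolution (w : ℝ → ℝ → ℝ → ℝ → ℝ → ℝ) (x : ℝ → ℝ → ℝ) : Prop where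
  meas : ∀ t, 0 ≤ t → Measurable (x t)
  absCont : ∀ α ∈ Icc (0:ℝ) 1, ∀ T, 0 ≤ T → AbsolutelyContinuousOn (fun t => x t α) 0 T
  init_mem : ∀ α ∈ Icc (0:ℝ) 1, x 0 α ∈ Icc (0:ℝ) 1
  locBdd : ∀ T, 0 ≤ T → ∃ M : ℝ, ∀ α ∈ Icc (0:ℝ) 1, ∀ t ∈ Icc (0:ℝ) T, |x t α| ≤ M
  ode : ∀ α ∈ Icc (0:ℝ) 1, ∀ᵐ t ∂(volume.restrict (Ici (0:ℝ))),
    HasDerivAt (fun s => x s α) (interactionField w x t α) t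

/-- The weight function is symmetric. -/
def SymmetricWeight (w : ℝ → ℝ → ℝ → ℝ → ℝ → ℝ) : Prop :=
  ∀ t α β a b, w t α β a b = w t β α b a

/-- `w ∈ Γ(r,Δ)`: the weight is at least `Δ` whenever the two opinions are within `r`. -/
def InGamma (r Δ : ℝ) (w : ℝ → ℝ → ℝ → ℝ → ℝ → ℝ) : Prop :=
  ∀ t, 0 ≤ t → ∀ α ∈ Icc (0:ℝ) 1, ∀ β ∈ Icc (0:ℝ) 1, ∀ a b : ℝ,
    |a - b| ≤ r → Δ ≤ w t α β a b

/-- The opinion distribution `μ_t`: pushforward of Lebesgue measure on `[0,1]` by `x_t`. -/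
noncomputable def opinionMeasure (x : ℝ → ℝ → ℝ) (t : ℝ) : Measure ℝ :=
  (volume.restrict (Icc (0:ℝ) 1)).map (x t)

/-- The order of the opinions is preserved: if agent `β`'s opinion is strictly above
agent `α`'s at some time, it is strictly above at every time. -/
def OrderPreserved (x : ℝ → ℝ → ℝ) : Prop :=
  ∀ α ∈ Icc (0:ℝ) 1, ∀ β ∈ Icc (0:ℝ) 1, ∀ s, 0 ≤ s → ∀ t, 0 ≤ t →
    x t α < x t β → x s α < x s β

/-- The `ε`-`δ` notion of absolute continuity implies Mathlib's. -/
lemma AbsolutelyContinuousOn.absolutelyContinuousOnInterval {f : ℝ → ℝ} {a b : ℝ} (hab : a ≤ b)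
    (hf : AbsolutelyContinuousOn f a b) : AbsolutelyContinuousOnInterval f a b := by
  rw [absolutelyContinuousOnInterval_iff]
  intro ε hε
  obtain ⟨δ, hδ, h⟩ := hf ε hε
  refine ⟨δ, hδ, ?_⟩
  rintro ⟨n, I⟩ ⟨hI, hdisj⟩ hlen
  simp only [Finset.mem_range, uIcc_of_le hab, mem_Icc] at hI
  simp only at hlen
  have key := h n (fun i => min (I i).1 (I i).2) (fun i => max (I i).1 (I i).2) ?_ ?_ ?_
  · rw [Finset.sum_range]
    refine lt_of_eq_of_lt (Finset.sum_congr rfl fun i _ => ?_) key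
    rw [Real.dist_eq]
    rcases le_total (I i).1 (I i).2 with hi | hi
    · simp only [min_eq_left hi, max_eq_right hi, abs_sub_comm]
    · simp only [min_eq_right hi, max_eq_left hi]
  · intro i
    obtain ⟨h1, h2⟩ := hI i i.2
    exact ⟨le_min h1.1 h2.1, min_le_max, max_le h1.2 h2.2⟩
  · intro i j hij
    have hd : Disjoint (uIoc (I i).1 (I i).2) (uIoc (I j).1 (I j).2) :=
      hdisj (by simp) (by simp) (fun h => hij (Fin.ext h))
    exact disjoint_iff_inter_eq_empty.mp (hd.mono Ioo_subset_Ioc_self Ioo_subset_Ioc_self)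
  · rw [Finset.sum_range] at hlen
    refine lt_of_eq_of_lt (Finset.sum_congr rfl fun i _ => ?_) hlen
    rw [Real.dist_eq, max_sub_min_eq_abs']

/-- Lebesgue measure on the space `[0,1]` of agents. -/
noncomputable abbrev agentMeasure : Measure ℝ := volume.restrict (Icc (0:ℝ) 1)

lemma ae_agentMeasure_prod_mem :
    ∀ᵐ p ∂(agentMeasure.prod agentMeasure), p.1 ∈ Icc (0:ℝ) 1 ∧ p.2 ∈ Icc (0:ℝ) 1 := by
  rw [agentMeasure, Measure.prod_restrict]
  exact ae_restrict_of_forall_mem (measurableSet_Icc.prod measurableSet_Icc) fun p hp => hp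

lemma interactionField_eq_integral_agentMeasure (w : ℝ → ℝ → ℝ → ℝ → ℝ → ℝ) (x : ℝ → ℝ → ℝ)
    (t α : ℝ) :
    interactionField w x t α =
      ∫ β, w t α β (x t α) (x t β) * (x t β - x t α) ∂agentMeasure := by
  rw [interactionField, intervalIntegral.integral_of_le zero_le_one, integral_Icc_eq_integral_Ioc]

lemma IsWeight.abs_mul_sub_le {W M : ℝ} {w : ℝ → ℝ → ℝ → ℝ → ℝ → ℝ} (hw : IsWeight W w)
    {t α β a b : ℝ} (ht : 0 ≤ t) (hα : α ∈ Icc (0:ℝ) 1) (hβ : β ∈ Icc (0:ℝ) 1)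
    (ha : |a| ≤ M) (hb : |b| ≤ M) : |w t α β a b * (b - a)| ≤ W * (2 * M) := by
  have h0 := hw.nonneg t ht α hα β hβ a b
  have h1 := hw.le_bound t ht α hα β hβ a b
  rw [abs_mul, abs_of_nonneg h0]
  gcongr
  · exact h0.trans h1
  · linarith [abs_sub b a]

lemma abs_interactionField_le {W M : ℝ} {w : ℝ → ℝ → ℝ → ℝ → ℝ → ℝ} {x : ℝ → ℝ → ℝ}
    (hw : IsWeight W w) {t α : ℝ} (ht : 0 ≤ t) (hα : α ∈ Icc (0:ℝ) 1)
    (hM : ∀ β ∈ Icc (0:ℝ) 1, |x t β| ≤ M) : |interactionField w x t α| ≤ W * (2 * M) := by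
  rw [interactionField_eq_integral_agentMeasure, ← Real.norm_eq_abs]
  have := norm_integral_le_of_norm_le_const (μ := agentMeasure) (C := W * (2 * M))
    (f := fun β => w t α β (x t α) (x t β) * (x t β - x t α))
    (ae_restrict_of_forall_mem measurableSet_Icc fun β hβ =>
      hw.abs_mul_sub_le ht hα hβ (hM α hα) (hM β hβ))
  simpa using this

/-- Along a solution the squared opinion of an agent obeys the fundamental theorem of calculus. -/
lemma IsSolution.sq_sub_sq_eq_integral {w : ℝ → ℝ → ℝ → ℝ → ℝ → ℝ} {x : ℝ → ℝ → ℝ}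
    (hx : IsSolution w x) {S T α : ℝ} (hS : 0 ≤ S) (hST : S ≤ T) (hα : α ∈ Icc (0:ℝ) 1) :
    x T α ^ 2 - x S α ^ 2 = ∫ t in S..T, 2 * (x t α * interactionField w x t α) := by
  have hac : AbsolutelyContinuousOnInterval (fun t => x t α) S T := by
    refine ((hx.absCont α hα T (hS.trans hST)).absolutelyContinuousOnInterval
      (hS.trans hST)).mono ?_
    rw [uIcc_of_le hST, uIcc_of_le (hS.trans hST)]
    exact Icc_subset_Icc_left hS
  have h := hac.integral_deriv_mul_eq_sub hac
  rw [sq, sq, ← h]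
  refine intervalIntegral.integral_congr_ae ?_
  filter_upwards [(ae_restrict_iff' measurableSet_Ici).mp (hx.ode α hα)] with t ht htST
  rw [uIoc_of_le hST] at htST
  rw [(ht (hS.trans htST.1.le)).deriv]
  ring

/-- The rate at which the energy `∫ x_t(α)² dα` is dissipated. -/
noncomputable def dissipation (w : ℝ → ℝ → ℝ → ℝ → ℝ → ℝ) (x : ℝ → ℝ → ℝ) (t : ℝ) : ℝ :=
  ∫ p, w t p.1 p.2 (x t p.1) (x t p.2) * (x t p.2 - x t p.1) ^ 2 ∂(agentMeasure.prod agentMeasure)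

lemma IsWeight.measurable_weight {W : ℝ} {w : ℝ → ℝ → ℝ → ℝ → ℝ → ℝ} (hw : IsWeight W w)
    {y : ℝ → ℝ} (hy : Measurable y) (t : ℝ) :
    Measurable fun p : ℝ × ℝ => w t p.1 p.2 (y p.1) (y p.2) :=
  hw.measurable.comp (g := fun q : ℝ × ℝ × ℝ × ℝ × ℝ => w q.1 q.2.1 q.2.2.1 q.2.2.2.1 q.2.2.2.2)
    (f := fun p : ℝ × ℝ => (t, p.1, p.2, y p.1, y p.2)) (by fun_prop)

lemma IsSolution.exists_bound {w : ℝ → ℝ → ℝ → ℝ → ℝ → ℝ} {x : ℝ → ℝ → ℝ} (hx : IsSolution w x)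
    {T : ℝ} (hT : 0 ≤ T) :
    ∃ M : ℝ, 0 ≤ M ∧ ∀ α ∈ Icc (0:ℝ) 1, ∀ t ∈ Icc (0:ℝ) T, |x t α| ≤ M := by
  obtain ⟨M, hM⟩ := hx.locBdd T hT
  exact ⟨M, (abs_nonneg _).trans (hM 0 (by simp) 0 ⟨le_rfl, hT⟩), hM⟩

/-- For a symmetric weight, the energy changes at rate minus the dissipation. -/
lemma integral_mul_interactionField_eq_neg_dissipation {W : ℝ} {w : ℝ → ℝ → ℝ → ℝ → ℝ → ℝ}
    {x : ℝ → ℝ → ℝ} (hw : IsWeight W w) (hsym : SymmetricWeight w) (hx : IsSolution w x)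
    {t : ℝ} (ht : 0 ≤ t) :
    ∫ α, 2 * (x t α * interactionField w x t α) ∂agentMeasure = - dissipation w x t := by
  obtain ⟨M, hM0, hM⟩ := hx.exists_bound ht
  have hMt : ∀ α ∈ Icc (0:ℝ) 1, |x t α| ≤ M := fun α hα => hM α hα t ⟨ht, le_rfl⟩
  have hxm := hx.meas t ht
  have hk := hw.measurable_weight hxm t
  let G : ℝ × ℝ → ℝ := fun p =>
    x t p.1 * (w t p.1 p.2 (x t p.1) (x t p.2) * (x t p.2 - x t p.1))
  have hGm : Measurable G := (hxm.comp measurable_fst).mul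
    (hk.mul ((hxm.comp measurable_snd).sub (hxm.comp measurable_fst)))
  have hG : Integrable G (agentMeasure.prod agentMeasure) := by
    refine Integrable.of_bound hGm.aestronglyMeasurable (M * (W * (2 * M))) ?_
    filter_upwards [ae_agentMeasure_prod_mem] with p hp
    rw [Real.norm_eq_abs, abs_mul]
    gcongr
    · exact hMt _ hp.1
    · exact hw.abs_mul_sub_le ht hp.1 hp.2 (hMt _ hp.1) (hMt _ hp.2)
  have h1 : ∫ α, 2 * (x t α * interactionField w x t α) ∂agentMeasure =
      2 * ∫ p, G p ∂(agentMeasure.prod agentMeasure) := by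
    rw [integral_const_mul, integral_prod G hG]
    congr 1
    refine integral_congr_ae (Eventually.of_forall fun α => ?_)
    simp only [G]
    rw [integral_const_mul, interactionField_eq_integral_agentMeasure]
  have h2 : ∫ p : ℝ × ℝ, G p.swap ∂(agentMeasure.prod agentMeasure) =
      ∫ p, G p ∂(agentMeasure.prod agentMeasure) := integral_prod_swap G
  rw [h1, two_mul]
  nth_rewrite 2 [← h2]
  rw [← integral_add hG (g := fun p : ℝ × ℝ => G p.swap) hG.swap, dissipation, ← integral_neg]
  refine integral_congr_ae (Eventually.of_forall fun p => ?_)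
  simp only [G, Prod.fst_swap, Prod.snd_swap]
  rw [hsym t p.2 p.1]
  ring

/-- The integrand of the energy balance is integrable in agents and time. -/
lemma integrable_mul_interactionField {W : ℝ} {w : ℝ → ℝ → ℝ → ℝ → ℝ → ℝ}
    {x : ℝ → ℝ → ℝ} (hw : IsWeight W w) (hx : IsSolution w x) {S T : ℝ} (hS : 0 ≤ S)
    (hST : S ≤ T) :
    Integrable (fun p : ℝ × ℝ => 2 * (x p.1 p.2 * interactionField w x p.1 p.2))
      ((volume.restrict (Ioc S T)).prod agentMeasure) := by
  obtain ⟨M, hM0, hM⟩ := hx.exists_bound (hS.trans hST)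
  have hmem : ∀ᵐ p ∂((volume.restrict (Ioc S T)).prod agentMeasure),
      p.1 ∈ Ioc S T ∧ p.2 ∈ Icc (0:ℝ) 1 := by
    rw [agentMeasure, Measure.prod_restrict]
    exact ae_restrict_of_forall_mem (measurableSet_Ioc.prod measurableSet_Icc) fun p hp => hp
  let u : ℝ → ℝ → ℝ := fun t => (Icc (0:ℝ) 1).indicator (x (max t 0))
  have hu_meas : Measurable (Function.uncurry u) := by
    refine measurable_uncurry_of_continuous_of_measurable (fun α => ?_)
      (fun t => (hx.meas _ (le_max_right _ _)).indicator measurableSet_Icc)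
    by_cases hα : α ∈ Icc (0:ℝ) 1
    · simp only [u, indicator_of_mem hα]
      have hc : ContinuousOn (fun t => x t α) (Ici 0) := by
        intro t ht
        have ht0 : (0:ℝ) ≤ t + 1 := by linarith [mem_Ici.mp ht]
        have := ((hx.absCont α hα _ ht0).absolutelyContinuousOnInterval ht0).continuousOn
        rw [uIcc_of_le ht0] at this
        refine (this t ⟨ht, by linarith⟩).mono_of_mem_nhdsWithin ?_
        rw [← Ici_inter_Iic]
        exact inter_mem self_mem_nhdsWithin (mem_nhdsWithin_of_mem_nhds (Iic_mem_nhds (by linarith)))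
      exact hc.comp_continuous (by fun_prop) (fun t => mem_Ici.mpr (le_max_right _ _))
    · simp only [u, indicator_of_notMem hα]
      exact continuous_const
  have hF_meas : StronglyMeasurable fun p : ℝ × ℝ =>
      ∫ β, w p.1 p.2 β (u p.1 p.2) (u p.1 β) * (u p.1 β - u p.1 p.2) ∂agentMeasure := by
    have h1 : Measurable fun q : (ℝ × ℝ) × ℝ => u q.1.1 q.1.2 :=
      hu_meas.comp (by fun_prop : Measurable fun q : (ℝ × ℝ) × ℝ => (q.1.1, q.1.2))
    have h2 : Measurable fun q : (ℝ × ℝ) × ℝ => u q.1.1 q.2 :=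
      hu_meas.comp (by fun_prop : Measurable fun q : (ℝ × ℝ) × ℝ => (q.1.1, q.2))
    have h3 : Measurable fun q : (ℝ × ℝ) × ℝ =>
        w q.1.1 q.1.2 q.2 (u q.1.1 q.1.2) (u q.1.1 q.2) :=
      hw.measurable.comp
        (g := fun q : ℝ × ℝ × ℝ × ℝ × ℝ => w q.1 q.2.1 q.2.2.1 q.2.2.2.1 q.2.2.2.2)
        (f := fun q : (ℝ × ℝ) × ℝ => (q.1.1, q.1.2, q.2, u q.1.1 q.1.2, u q.1.1 q.2))
        (by fun_prop)
    exact (h3.mul (h2.sub h1)).stronglyMeasurable.integral_prod_right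
  refine Integrable.of_bound (C := 2 * (M * (W * (2 * M))))
    (AEStronglyMeasurable.congr
      ((hu_meas.stronglyMeasurable.mul hF_meas).const_mul 2).aestronglyMeasurable ?_) ?_
  · filter_upwards [hmem] with p hp
    have hu : ∀ β ∈ Icc (0:ℝ) 1, u p.1 β = x p.1 β := fun β hβ => by
      simp only [u, indicator_of_mem hβ, max_eq_left (hS.trans hp.1.1.le)]
    simp only [Pi.mul_apply, Function.uncurry, hu p.2 hp.2,
      interactionField_eq_integral_agentMeasure]
    congr 2
    refine integral_congr_ae (ae_restrict_of_forall_mem measurableSet_Icc fun β hβ => ?_)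
    simp only [hu β hβ]
  · filter_upwards [hmem] with p hp
    have ht : p.1 ∈ Icc 0 T := ⟨hS.trans hp.1.1.le, hp.1.2⟩
    rw [Real.norm_eq_abs, abs_mul, abs_mul, abs_two]
    gcongr
    · exact hM _ hp.2 _ ht
    · exact abs_interactionField_le hw ht.1 hp.2 fun β hβ => hM β hβ _ ht

/-- The dissipation cannot be bounded below by a positive constant for all large times, because
the energy is nonnegative. -/
lemma not_forall_ge_le_dissipation {W : ℝ} {w : ℝ → ℝ → ℝ → ℝ → ℝ → ℝ}
    {x : ℝ → ℝ → ℝ} (hw : IsWeight W w) (hsym : SymmetricWeight w) (hx : IsSolution w x)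
    {S c : ℝ} (hS : 0 ≤ S) (hc : 0 < c) : ¬ ∀ t, S ≤ t → c ≤ dissipation w x t := by
  intro h
  have hE : ∀ t, 0 ≤ t → Integrable (fun α => x t α ^ 2) agentMeasure := fun t ht => by
    obtain ⟨M, hM0, hM⟩ := hx.exists_bound ht
    refine Integrable.of_bound ((hx.meas t ht).pow_const 2).aestronglyMeasurable (M ^ 2) ?_
    refine ae_restrict_of_forall_mem measurableSet_Icc fun α hα => ?_
    rw [norm_pow, Real.norm_eq_abs]
    gcongr
    exact hM α hα t ⟨ht, le_rfl⟩
  have hE0 : ∀ t, 0 ≤ ∫ α, x t α ^ 2 ∂agentMeasure :=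
    fun t => integral_nonneg fun α => sq_nonneg _
  set T := S + ((∫ α, x S α ^ 2 ∂agentMeasure) / c + 1) with hT
  have hST : S ≤ T := by
    have := div_nonneg (hE0 S) hc.le
    linarith
  have hint := integrable_mul_interactionField hw hx hS hST
  have hbal : (∫ α, x T α ^ 2 ∂agentMeasure) - ∫ α, x S α ^ 2 ∂agentMeasure =
      ∫ t in S..T, ∫ α, 2 * (x t α * interactionField w x t α) ∂agentMeasure := by
    rw [← integral_sub (hE T (hS.trans hST)) (hE S hS), intervalIntegral.integral_of_le hST,
      integral_integral_swap hint]
    refine integral_congr_ae (ae_restrict_of_forall_mem measurableSet_Icc fun α hα => ?_)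
    simp only
    rw [hx.sq_sub_sq_eq_integral hS hST hα, intervalIntegral.integral_of_le hST]
  have hle : ∫ t in S..T, ∫ α, 2 * (x t α * interactionField w x t α) ∂agentMeasure ≤
      ∫ _ in S..T, -c := by
    refine intervalIntegral.integral_mono_on hST ?_ (by simp) fun t ht => ?_
    · rw [intervalIntegrable_iff_integrableOn_Ioc_of_le hST]
      exact hint.integral_prod_left
    · rw [integral_mul_interactionField_eq_neg_dissipation hw hsym hx (hS.trans ht.1)]
      exact neg_le_neg (h t ht.1)
  rw [← hbal, intervalIntegral.integral_const, smul_eq_mul, hT, add_sub_cancel_left] at hle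
  have : ((∫ α, x S α ^ 2 ∂agentMeasure) / c + 1) * -c = -(∫ α, x S α ^ 2 ∂agentMeasure) - c := by
    field_simp
    ring
  linarith [hE0 T]

/-- The dissipation controls products of masses of opinions at distance between `δ` and `r`. -/
lemma mul_integral_mul_integral_le_dissipation {W r Δ δ : ℝ} {w : ℝ → ℝ → ℝ → ℝ → ℝ → ℝ}
    {x : ℝ → ℝ → ℝ} (hw : IsWeight W w) (hΓ : InGamma r Δ w) (hx : IsSolution w x)
    (hΔ : 0 ≤ Δ) (hδ : 0 ≤ δ) (f g : BoundedContinuousFunction ℝ ℝ)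
    (hf : ∀ a, 0 ≤ f a ∧ f a ≤ 1) (hg : ∀ a, 0 ≤ g a ∧ g a ≤ 1)
    (hfg : ∀ a b, f a ≠ 0 → g b ≠ 0 → δ ≤ |a - b| ∧ |a - b| ≤ r) {t : ℝ} (ht : 0 ≤ t) :
    Δ * δ ^ 2 * ((∫ y, f y ∂(opinionMeasure x t)) * ∫ y, g y ∂(opinionMeasure x t)) ≤
      dissipation w x t := by
  obtain ⟨M, hM0, hM⟩ := hx.exists_bound ht
  have hMt : ∀ α ∈ Icc (0:ℝ) 1, |x t α| ≤ M := fun α hα => hM α hα t ⟨ht, le_rfl⟩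
  have hxm := hx.meas t ht
  have hk := hw.measurable_weight hxm t
  have hfm : Measurable fun α => f (x t α) := f.continuous.measurable.comp hxm
  have hgm : Measurable fun α => g (x t α) := g.continuous.measurable.comp hxm
  rw [opinionMeasure, integral_map hxm.aemeasurable f.continuous.aestronglyMeasurable,
    integral_map hxm.aemeasurable g.continuous.aestronglyMeasurable, ← integral_prod_mul,
    ← integral_const_mul, dissipation]
  refine integral_mono_ae ?_ ?_ ?_
  · refine Integrable.of_bound (((hfm.comp measurable_fst).mul (hgm.comp measurable_snd)).const_mul
      (Δ * δ ^ 2)).aestronglyMeasurable (Δ * δ ^ 2 * (1 * 1)) (Eventually.of_forall fun p => ?_)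
    have h1 := hf (x t p.1)
    have h2 := hg (x t p.2)
    rw [Real.norm_eq_abs, abs_of_nonneg
      (mul_nonneg (by positivity) (mul_nonneg h1.1 h2.1))]
    gcongr
    · exact h2.1
    · exact h1.2
    · exact h2.2
  · refine Integrable.of_bound (hk.mul (((hxm.comp measurable_snd).sub
      (hxm.comp measurable_fst)).pow_const 2)).aestronglyMeasurable (W * (2 * M) * (2 * M)) ?_
    filter_upwards [ae_agentMeasure_prod_mem] with p hp
    rw [Real.norm_eq_abs, sq, ← mul_assoc, abs_mul]
    have h1 := hMt _ hp.1
    have h2 := hMt _ hp.2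
    have h3 := hw.abs_mul_sub_le ht hp.1 hp.2 h1 h2
    refine mul_le_mul h3 ?_ (abs_nonneg _) ((abs_nonneg _).trans h3)
    linarith [abs_sub (x t p.2) (x t p.1)]
  · filter_upwards [ae_agentMeasure_prod_mem] with p hp
    have hw0 := hw.nonneg t ht _ hp.1 _ hp.2 (x t p.1) (x t p.2)
    have h1 := hf (x t p.1)
    have h2 := hg (x t p.2)
    by_cases hne : f (x t p.1) ≠ 0 ∧ g (x t p.2) ≠ 0
    · obtain ⟨hlo, hhi⟩ := hfg _ _ hne.1 hne.2
      have hwΔ := hΓ t ht _ hp.1 _ hp.2 _ _ hhi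
      calc Δ * δ ^ 2 * (f (x t p.1) * g (x t p.2)) ≤ Δ * δ ^ 2 * 1 := by
            gcongr
            exact mul_le_one₀ h1.2 h2.1 h2.2
        _ ≤ _ := by
            rw [mul_one, abs_sub_comm] at *
            rw [← sq_abs (x t p.2 - x t p.1)]
            gcongr
    · have : f (x t p.1) * g (x t p.2) = 0 := by
        rw [mul_eq_zero]
        tauto
      simp only [this, mul_zero]
      positivity

/-- The tent function of radius `ε` around `c`. -/
noncomputable def tent (c ε : ℝ) : BoundedContinuousFunction ℝ ℝ :=
  BoundedContinuousFunction.ofNormedAddCommGroup (fun u => max 0 (1 - |u - c| / |ε|))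
    (by fun_prop) 1 fun u => by
      have : 0 ≤ |u - c| / |ε| := by positivity
      rw [Real.norm_eq_abs, abs_of_nonneg (le_max_left _ _)]
      exact max_le zero_le_one (by linarith)

lemma tent_mem_Icc (c ε u : ℝ) : 0 ≤ tent c ε u ∧ tent c ε u ≤ 1 := by
  have : 0 ≤ |u - c| / |ε| := by positivity
  exact ⟨le_max_left _ _, max_le zero_le_one (by linarith)⟩

lemma tent_ne_zero_iff {c ε : ℝ} (hε : 0 < ε) (u : ℝ) : tent c ε u ≠ 0 ↔ |u - c| < ε := by
  have h : tent c ε u = max 0 (1 - |u - c| / |ε|) := rfl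
  rw [h, ← (le_max_left (0:ℝ) _).lt_iff_ne', lt_max_iff, abs_of_pos hε, sub_pos, div_lt_one hε]
  simp

lemma integral_tent_pos {μ : Measure ℝ} [IsFiniteMeasure μ] {c ε : ℝ} (hε : 0 < ε)
    (hc : c ∈ μ.support) : 0 < ∫ u, tent c ε u ∂μ := by
  rw [integral_pos_iff_support_of_nonneg (fun u => (tent_mem_Icc c ε u).1)
    ((tent c ε).integrable μ)]
  have : Function.support (tent c ε) = Metric.ball c ε := by
    ext u
    rw [Function.mem_support, tent_ne_zero_iff hε, Metric.mem_ball, Real.dist_eq]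
  rw [this]
  exact (Measure.mem_support_iff_forall c).mp hc _ (Metric.ball_mem_nhds c hε)

/-- Distinct points of the support of the limit distribution are at distance at least `r`. -/
lemma le_abs_sub_of_mem_support {W r Δ : ℝ} (hΔ : 0 < Δ) {w : ℝ → ℝ → ℝ → ℝ → ℝ → ℝ}
    {x : ℝ → ℝ → ℝ} (hw : IsWeight W w) (hsym : SymmetricWeight w) (hΓ : InGamma r Δ w)
    (hx : IsSolution w x) {μlim : Measure ℝ} [IsFiniteMeasure μlim]
    (hconv : ∀ η : BoundedContinuousFunction ℝ ℝ,
      Tendsto (fun t => ∫ y, η y ∂(opinionMeasure x t)) atTop (𝓝 (∫ y, η y ∂μlim)))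
    {a b : ℝ} (ha : a ∈ μlim.support) (hb : b ∈ μlim.support) (hab : a ≠ b) : r ≤ |a - b| := by
  by_contra! hlt
  have hd : 0 < |a - b| := abs_pos.mpr (sub_ne_zero.mpr hab)
  set ε := min (|a - b| / 4) ((r - |a - b|) / 2) with hεdef
  have hε : 0 < ε := lt_min (by linarith) (by linarith)
  have hε1 : ε ≤ |a - b| / 4 := min_le_left _ _
  have hε2 : ε ≤ (r - |a - b|) / 2 := min_le_right _ _
  have hp := integral_tent_pos hε ha
  have hq := integral_tent_pos hε hb
  have hev := ((hconv (tent a ε)).mul (hconv (tent b ε))).eventually_const_lt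
    (half_lt_self (mul_pos hp hq))
  obtain ⟨S, hS⟩ := eventually_atTop.mp hev
  set m := (∫ y, tent a ε y ∂μlim) * ∫ y, tent b ε y ∂μlim with hm
  have hm0 : 0 < m := mul_pos hp hq
  refine not_forall_ge_le_dissipation hw hsym hx (le_max_right S 0)
    (c := Δ * (|a - b| / 2) ^ 2 * (m / 2)) (by positivity) fun t ht => ?_
  refine le_trans ?_ (mul_integral_mul_integral_le_dissipation hw hΓ hx hΔ.le
    (δ := |a - b| / 2) (by positivity) (tent a ε) (tent b ε) (tent_mem_Icc a ε) (tent_mem_Icc b ε)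
    (fun u v hu hv => ?_) ((le_max_right S 0).trans ht))
  · gcongr
    exact (hS t ((le_max_left S 0).trans ht)).le
  · rw [tent_ne_zero_iff hε] at hu hv
    constructor
    · have h1 := abs_sub_le a u b
      have h2 := abs_sub_le u v b
      rw [abs_sub_comm a u] at h1
      linarith
    · have h1 := abs_sub_le u a v
      have h2 := abs_sub_le a b v
      rw [abs_sub_comm b v] at h2
      linarith

/-- A subset of `[0,1]` whose distinct points are at distance at least `r > 0` is finite. -/
lemma finite_of_forall_le_abs_sub {s : Set ℝ} {r : ℝ} (hr : 0 < r) (hs : s ⊆ Icc 0 1)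
    (hsep : ∀ a ∈ s, ∀ b ∈ s, a ≠ b → r ≤ |a - b|) : s.Finite := by
  refine Set.Finite.of_finite_image (f := fun a => ⌊a / r⌋) ?_ ?_
  · refine (finite_Icc (0:ℤ) ⌊1 / r⌋).subset ?_
    rintro _ ⟨a, ha, rfl⟩
    have h := hs ha
    exact ⟨Int.floor_nonneg.mpr (div_nonneg h.1 hr.le), Int.floor_le_floor (by gcongr; exact h.2)⟩
  · intro a ha b hb hab
    by_contra hne
    have h1 := Int.abs_sub_lt_one_of_floor_eq_floor hab
    rw [← sub_div, abs_div, abs_of_pos hr, div_lt_one hr] at h1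
    exact absurd (hsep a ha b hb hne) (not_le.mpr h1)

/-- A point of the support that is at distance at least `r > 0` from the rest of the support is an
atom. -/
lemma measure_singleton_pos_of_mem_support {μ : Measure ℝ} {r z : ℝ} (hr : 0 < r)
    (hz : z ∈ μ.support) (hsep : ∀ b ∈ μ.support, z ≠ b → r ≤ |z - b|) : 0 < μ {z} := by
  have hpos := (Measure.mem_support_iff_forall z).mp hz _ (Metric.ball_mem_nhds z hr)
  have hsub : Metric.ball z r ⊆ {z} ∪ μ.supportᶜ := by
    intro b hb
    by_cases hbz : z = b
    · exact Or.inl hbz.symm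
    · refine Or.inr fun hbs => ?_
      rw [Metric.mem_ball, Real.dist_eq, abs_sub_comm] at hb
      exact absurd (hsep b hbs hbz) (not_le.mpr hb)
  calc 0 < μ (Metric.ball z r) := hpos
    _ ≤ μ ({z} ∪ μ.supportᶜ) := measure_mono hsub
    _ ≤ μ {z} + μ μ.supportᶜ := measure_union_le _ _
    _ = μ {z} := by rw [Measure.measure_compl_support, add_zero]

/-- Suppose the symmetric weight function belongs to `Γ(r,Δ)`, `x` is a
solution, and the opinion distributions converge in distribution to a finite Borel
measure `μ∞` on `[0,1]`. Then there are finitely many points `z_1,…,z_k ∈ [0,1]` and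
some `l > 0` such that every closed interval avoiding all the `z_i` is `μ∞`-null, while
every closed interval whose interior contains some `z_i` has `μ∞`-measure at least `l`. -/
theorem limit_measure_concentrates_on_finitely_many_points
    (W r Δ : ℝ) (hW : 0 < W) (hr : 0 < r) (hΔ : 0 < Δ)
    (w : ℝ → ℝ → ℝ → ℝ → ℝ → ℝ) (x : ℝ → ℝ → ℝ)
    (hw : IsWeight W w) (hsym : SymmetricWeight w) (hΓ : InGamma r Δ w)
    (hx : IsSolution w x)
    (μlim : Measure ℝ) (hfin : IsFiniteMeasure μlim) (hsupp : μlim (Icc (0:ℝ) 1)ᶜ = 0)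
    (hconv : ∀ η : BoundedContinuousFunction ℝ ℝ,
      Tendsto (fun t => ∫ y, η y ∂(opinionMeasure x t)) atTop
        (𝓝 (∫ y, η y ∂μlim))) :
    ∃ (k : ℕ) (z : Fin k → ℝ) (l : ℝ), 0 < l ∧ (∀ i, z i ∈ Icc (0:ℝ) 1) ∧
      (∀ a b : ℝ, a ≤ b → (∀ i, z i ∉ Icc a b) → μlim (Icc a b) = 0) ∧
      (∀ a b : ℝ, a ≤ b → (∃ i, z i ∈ interior (Icc a b)) →
        ENNReal.ofReal l ≤ μlim (Icc a b)) := by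
  have hsep : ∀ a ∈ μlim.support, ∀ b ∈ μlim.support, a ≠ b → r ≤ |a - b| :=
    fun a ha b hb hab => le_abs_sub_of_mem_support hΔ hw hsym hΓ hx hconv ha hb hab
  have hsub : μlim.support ⊆ Icc 0 1 := Measure.support_subset_of_isClosed isClosed_Icc hsupp
  have hfinite : μlim.support.Finite := finite_of_forall_le_abs_sub hr hsub hsep
  have := hfinite.to_subtype
  obtain ⟨k, ⟨e⟩⟩ := Finite.exists_equiv_fin μlim.support
  have hpos : ∀ i, 0 < μlim.real {(e.symm i : ℝ)} := fun i =>
    ENNReal.toReal_pos (measure_singleton_pos_of_mem_support hr (e.symm i).2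
      (hsep _ (e.symm i).2)).ne' (measure_ne_top _ _)
  obtain ⟨l, hl0, hl⟩ : ∃ l : ℝ, 0 < l ∧ ∀ i, l ≤ μlim.real {(e.symm i : ℝ)} := by
    rcases isEmpty_or_nonempty (Fin k) with hk | hk
    · exact ⟨1, one_pos, fun i => hk.elim i⟩
    · obtain ⟨i₀, hi₀⟩ := Finite.exists_min fun i => μlim.real {(e.symm i : ℝ)}
      exact ⟨_, hpos i₀, hi₀⟩
  refine ⟨k, fun i => e.symm i, l, hl0, fun i => hsub (e.symm i).2, ?_, ?_⟩
  · intro a b _ hz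
    refine measure_mono_null (fun u hu hus => hz (e ⟨u, hus⟩) ?_) Measure.measure_compl_support
    simpa using hu
  · rintro a b _ ⟨i, hi⟩
    calc ENNReal.ofReal l ≤ ENNReal.ofReal (μlim.real {(e.symm i : ℝ)}) :=
          ENNReal.ofReal_le_ofReal (hl i)
      _ = μlim {(e.symm i : ℝ)} := ofReal_measureReal
      _ ≤ μlim (Icc a b) := measure_mono (singleton_subset_iff.mpr (interior_subset hi))
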